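/- For every integer s ≥ 1, L(e^{1/s}, 1/2) = 1/8 and L(e^{1/s}, e^{1/s}/2) = 1/8. -/

import Mathlib

/-- Distance from a real number to the nearest integer. -/
noncomputable def distNearestInt (x : ℝ) : ℝ := |x - round x|

/-- The inhomogeneous approximation constant. -/
noncomputable def Lconst (θ φ : ℝ) : ℝ :=
  Filter.liminf (fun q : ℤ => |(q : ℝ)| * distNearestInt (q * θ - φ)) Filter.cofinite

open Filter

/-- The solution of the recurrence `u (n + 2) = (4 n + 6) s u (n + 1) + u n` with initial
values `a` and `b`. -/
def padeSeq (s a b : ℤ) : ℕ → ℤ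
  | 0 => a
  | 1 => b
  | n + 2 => (4 * n + 6) * s * padeSeq s a b (n + 1) + padeSeq s a b n

/-- Numerators of the diagonal Padé approximants of `exp` at `1 / s`. -/
def padeNum (s : ℤ) : ℕ → ℤ := padeSeq s 1 (2 * s + 1)

/-- Denominators of the diagonal Padé approximants of `exp` at `1 / s`. -/
def padeDen (s : ℤ) : ℕ → ℤ := padeSeq s 1 (2 * s - 1)

theorem padeSeq_odd {s a b : ℤ} (ha : Odd a) (hb : Odd b) (n : ℕ) : Odd (padeSeq s a b n) := by
  suffices h : Odd (padeSeq s a b n) ∧ Odd (padeSeq s a b (n + 1)) from h.1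
  induction n with
  | zero => exact ⟨ha, hb⟩
  | succ n ih =>
    refine ⟨ih.2, ?_⟩
    rw [padeSeq]
    refine Even.add_odd ?_ ih.1
    exact ⟨(2 * n + 3) * s * padeSeq s a b (n + 1), by ring⟩

theorem padeNum_odd (s : ℤ) (n : ℕ) : Odd (padeNum s n) :=
  padeSeq_odd odd_one ⟨s, rfl⟩ n

theorem padeDen_odd (s : ℤ) (n : ℕ) : Odd (padeDen s n) :=
  padeSeq_odd odd_one ⟨s - 1, by ring⟩ n

theorem padeNum_succ_succ (s : ℤ) (n : ℕ) :
    padeNum s (n + 2) = (4 * n + 6) * s * padeNum s (n + 1) + padeNum s n := rfl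

theorem padeDen_succ_succ (s : ℤ) (n : ℕ) :
    padeDen s (n + 2) = (4 * n + 6) * s * padeDen s (n + 1) + padeDen s n := rfl

theorem padeNum_mul_padeDen_sub (s : ℤ) (n : ℕ) :
    padeNum s (n + 1) * padeDen s n - padeNum s n * padeDen s (n + 1) = 2 * (-1) ^ n := by
  induction n with
  | zero => simp only [padeNum, padeDen, padeSeq]; ring
  | succ n ih =>
    rw [padeNum_succ_succ, padeDen_succ_succ, pow_succ]
    linear_combination -ih

theorem padeDen_pos {s : ℤ} (hs : 1 ≤ s) (n : ℕ) : 0 < padeDen s n := by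
  suffices h : 0 < padeDen s n ∧ 0 < padeDen s (n + 1) from h.1
  induction n with
  | zero => simp only [padeDen, padeSeq]; omega
  | succ n ih =>
    refine ⟨ih.2, ?_⟩
    rw [padeDen_succ_succ]
    have := ih.1
    have := ih.2
    positivity

theorem mul_padeDen_le {s : ℤ} (hs : 1 ≤ s) (n : ℕ) :
    n * padeDen s n ≤ padeDen s (n + 1) := by
  cases n with
  | zero => simpa using (padeDen_pos hs 1).le
  | succ n =>
    rw [padeDen_succ_succ]
    have h0 := padeDen_pos hs n
    have h1 := padeDen_pos hs (n + 1)
    have h2 : ((n + 1 : ℕ) : ℤ) ≤ (4 * n + 6) * s := by push_cast; nlinarith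
    nlinarith

theorem le_padeDen_succ {s : ℤ} (hs : 1 ≤ s) (n : ℕ) : (n : ℤ) ≤ padeDen s (n + 1) := by
  have h0 := padeDen_pos hs n
  have h1 := mul_padeDen_le hs n
  nlinarith

/-- The terms of the series for the remainder of the `n`-th Padé approximant. -/
noncomputable def padeRemTerm (t : ℝ) (n k : ℕ) : ℝ :=
  ((n + k).factorial : ℝ) / (k.factorial * (2 * n + k + 1).factorial) * t ^ (n + k + 1)

/-- The absolute value of the remainder of the `n`-th Padé approximant of `exp` at `t`. -/
noncomputable def padeRem (t : ℝ) (n : ℕ) : ℝ := ∑' k, padeRemTerm t n k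

theorem padeRemTerm_pos {t : ℝ} (ht : 0 < t) (n k : ℕ) : 0 < padeRemTerm t n k := by
  unfold padeRemTerm; positivity

theorem summable_padeRemTerm {t : ℝ} (ht : 0 < t) (n : ℕ) : Summable (padeRemTerm t n) := by
  refine Summable.of_nonneg_of_le (fun k => (padeRemTerm_pos ht n k).le) (fun k => ?_)
    ((Real.summable_pow_div_factorial t).mul_left (t ^ (n + 1)))
  have h : ((n + k).factorial : ℝ) ≤ (2 * n + k + 1).factorial := by
    exact_mod_cast Nat.factorial_le (by omega)
  have e : padeRemTerm t n k = ((n + k).factorial : ℝ) / (2 * n + k + 1).factorial *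
      (t ^ (n + 1) * (t ^ k / k.factorial)) := by
    unfold padeRemTerm
    field_simp
    ring
  rw [e]
  refine mul_le_of_le_one_left (by positivity) ?_
  exact div_le_one_of_le₀ h (by positivity)

theorem padeRem_pos {t : ℝ} (ht : 0 < t) (n : ℕ) : 0 < padeRem t n :=
  (summable_padeRemTerm ht n).tsum_pos (fun k => (padeRemTerm_pos ht n k).le) 0
    (padeRemTerm_pos ht n 0)

theorem padeRem_recurrence {t : ℝ} (ht : 0 < t) (n : ℕ) :
    padeRem t n = (4 * n + 6) / t * padeRem t (n + 1) + padeRem t (n + 2) := by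
  have h1 := (summable_padeRemTerm ht n).hasSum
  have h2 := ((summable_padeRemTerm ht (n + 1)).hasSum).mul_left ((4 * n + 6) / t)
  have h3 := h1.sub h2
  have h4 := (hasSum_nat_add_iff' 2).mpr h3
  have e : (fun k => padeRemTerm t n (k + 2) - (4 * n + 6) / t * padeRemTerm t (n + 1) (k + 2)) =
      padeRemTerm t (n + 2) := by
    funext k
    have e1 : n + 1 + (k + 2) = (n + k + 2) + 1 := by ring
    have e2 : 2 * (n + 1) + (k + 2) + 1 = (2 * n + k + 3) + 1 + 1 := by ring
    have e3 : n + (k + 2) = n + k + 2 := by ring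
    have e4 : 2 * n + (k + 2) + 1 = 2 * n + k + 3 := by ring
    have e5 : n + 2 + k = n + k + 2 := by ring
    have e6 : 2 * (n + 2) + k + 1 = (2 * n + k + 3) + 1 + 1 := by ring
    simp only [padeRemTerm, e1, e2, e3, e4, e5, e6, Nat.factorial_succ (n + k + 2),
      Nat.factorial_succ (2 * n + k + 3 + 1), Nat.factorial_succ (2 * n + k + 3),
      Nat.factorial_succ (k + 1), Nat.factorial_succ k, pow_succ _ (n + k + 2 + 1)]
    push_cast
    field_simp
    ring
  rw [e] at h4
  have h5 := h4.unique (summable_padeRemTerm ht (n + 2)).hasSum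
  have h6 : ∑ i ∈ Finset.range 2,
      (padeRemTerm t n i - (4 * n + 6) / t * padeRemTerm t (n + 1) i) = 0 := by
    have e2 : 2 * (n + 1) + 1 = (2 * n + 1) + 1 + 1 := by ring
    simp only [Finset.sum_range_succ, Finset.sum_range_zero, padeRemTerm, add_zero, e2,
      Nat.factorial_succ (n + 1), Nat.factorial_succ n,
      Nat.factorial_succ (2 * n + 1 + 1 + 1),
      Nat.factorial_succ (2 * n + 1 + 1), Nat.factorial_succ (2 * n + 1)]
    push_cast
    field_simp
    ring
  rw [h6] at h5
  rw [← padeRem, ← padeRem, ← padeRem] at h5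
  linarith

theorem padeRem_zero {t : ℝ} (ht : 0 < t) : padeRem t 0 = Real.exp t - 1 := by
  have h := (hasSum_nat_add_iff' 1).mpr (NormedSpace.expSeries_div_hasSum_exp t)
  rw [← Real.exp_eq_exp_ℝ] at h
  have e : padeRemTerm t 0 = fun k => t ^ (k + 1) / (k + 1).factorial := by
    funext k
    simp only [padeRemTerm, zero_add, mul_zero]
    field_simp
  rw [padeRem, e, h.tsum_eq]
  simp

theorem padeRem_one {t : ℝ} (ht : 0 < t) :
    padeRem t 1 = (2 / t + 1) - (2 / t - 1) * Real.exp t := by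
  have h0 := NormedSpace.expSeries_div_hasSum_exp t
  rw [← Real.exp_eq_exp_ℝ] at h0
  have h2 := (hasSum_nat_add_iff' 2).mpr h0
  have h3 := ((hasSum_nat_add_iff' 3).mpr h0).mul_left (2 / t)
  have h := h2.sub h3
  have e : padeRemTerm t 1 = fun k => t ^ (k + 2) / (k + 2).factorial -
      2 / t * (t ^ (k + 3) / (k + 3).factorial) := by
    funext k
    have e1 : 2 * 1 + k + 1 = (k + 2) + 1 := by ring
    have e2 : 1 + k = k + 1 := by ring
    simp only [padeRemTerm, e1, e2, Nat.factorial_succ (k + 2), Nat.factorial_succ (k + 1),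
      Nat.factorial_succ k]
    push_cast
    field_simp
    ring
  rw [padeRem, e, h.tsum_eq]
  simp only [Finset.sum_range_succ, Finset.sum_range_zero, Nat.factorial]
  push_cast
  field_simp
  ring

theorem padeDen_mul_exp_sub_padeNum {s : ℕ} (hs : 1 ≤ s) (n : ℕ) :
    padeDen s n * Real.exp (1 / s) - padeNum s n = (-1) ^ n * padeRem (1 / s) n := by
  have hs0 : (0 : ℝ) < s := by exact_mod_cast hs
  have ht : (0 : ℝ) < 1 / s := by positivity
  suffices h : padeDen s n * Real.exp (1 / s) - padeNum s n = (-1) ^ n * padeRem (1 / s) n ∧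
      padeDen s (n + 1) * Real.exp (1 / s) - padeNum s (n + 1) =
        (-1) ^ (n + 1) * padeRem (1 / s) (n + 1) from h.1
  induction n with
  | zero =>
    rw [zero_add, padeRem_zero ht, padeRem_one ht]
    simp only [padeDen, padeNum, padeSeq]
    push_cast
    constructor
    · ring
    · rw [div_div_eq_mul_div]
      ring
  | succ n ih =>
    refine ⟨ih.2, ?_⟩
    have h := padeRem_recurrence ht n
    rw [div_div_eq_mul_div, div_one] at h
    rw [padeNum_succ_succ, padeDen_succ_succ]
    push_cast
    simp only [pow_succ] at ih ⊢
    linear_combination (4 * n + 6) * s * ih.2 + ih.1 + (-1) ^ n * h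

theorem padeDen_mul_padeRem {s : ℕ} (hs : 1 ≤ s) (n : ℕ) :
    padeDen s (n + 1) * padeRem (1 / s) n + padeDen s n * padeRem (1 / s) (n + 1) = 2 := by
  have h0 := padeDen_mul_exp_sub_padeNum hs n
  have h1 := padeDen_mul_exp_sub_padeNum hs (n + 1)
  have h2 : (padeNum s (n + 1) * padeDen s n - padeNum s n * padeDen s (n + 1) : ℝ)
    = 2 * (-1) ^ n := by exact_mod_cast padeNum_mul_padeDen_sub s n
  have h3 : ((-1) ^ n * (-1) ^ n : ℝ) = 1 := by rw [← mul_pow]; simp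
  rw [pow_succ] at h1
  linear_combination (-(-1) ^ n * padeDen s (n + 1)) * h0 + ((-1) ^ n * padeDen s n) * h1 +
    (-1) ^ n * h2 + (2 - padeDen s (n + 1) * padeRem (1 / s) n -
      padeDen s n * padeRem (1 / s) (n + 1)) * h3

theorem mul_padeRem_succ_le {s : ℕ} (hs : 1 ≤ s) (n : ℕ) :
    n * padeRem (1 / s) (n + 1) ≤ padeRem (1 / s) n := by
  have hs0 : (1 : ℝ) ≤ s := by exact_mod_cast hs
  have ht : (0 : ℝ) < 1 / s := by positivity
  have h := padeRem_recurrence ht n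
  rw [div_div_eq_mul_div, div_one] at h
  have h1 := padeRem_pos ht (n + 1)
  have h2 := padeRem_pos ht (n + 2)
  have h3 : (n : ℝ) ≤ (4 * n + 6) * s := by nlinarith [(Nat.cast_nonneg n : (0 : ℝ) ≤ n)]
  nlinarith

/-- Lower bound for the product of two linear forms evaluated at odd integers. -/
theorem le_abs_mul_abs_of_odd {q q' d d' ε : ℝ} (hq : 0 < q) (hd : 0 < d)
    (hd' : 0 < d') (hε : 0 < ε) (hε1 : ε ≤ 1) (hdet : q' * d + q * d' = 2) (hqq : q ≤ ε * q')
    (hdd : d' ≤ ε * d) {x y : ℤ} (hx : Odd x) (hy : Odd y)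
    (h1 : q ≤ |(x * q + y * q') / 2|) (h2 : |(x * q + y * q') / 2| < q') :
    1 / 2 - ε ≤ |(x * q + y * q') / 2| * |(x * d - y * d') / 2| := by
  have hq' : 0 < q' := by nlinarith
  have hmain : 2 * (1 - ε) ≤ q' * d := by
    have : q * d' ≤ (ε * q') * (ε * d) := by gcongr
    have h3 : 0 < q' * d := by positivity
    nlinarith [mul_nonneg hε.le (sub_nonneg.2 hε1), mul_pos h3 hε]
  have hfin : 1 / 2 - ε ≤ (1 - ε) * (q' * d) / 4 := by
    nlinarith [mul_le_mul_of_nonneg_left hmain (sub_nonneg.2 hε1), sq_nonneg ε]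
  wlog hx0 : 0 < x generalizing x y
  · have hx1 : 0 < -x := by
      rcases hx with ⟨k, hk⟩
      omega
    have e1 : |(((-x : ℤ) : ℝ) * q + ((-y : ℤ) : ℝ) * q') / 2| = |(x * q + y * q') / 2| := by
      rw [← abs_neg]; congr 1; push_cast; ring
    have e2 : |(((-x : ℤ) : ℝ) * d - ((-y : ℤ) : ℝ) * d') / 2| = |(x * d - y * d') / 2| := by
      rw [← abs_neg]; congr 1; push_cast; ring
    have := this hx.neg hy.neg (by rwa [e1]) (by rwa [e1]) hx1
    rwa [e1, e2] at this
  have hX : (1 : ℝ) ≤ x := by exact_mod_cast hx0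
  refine hfin.trans ?_
  rcases lt_or_ge y 0 with hy0 | hy0
  · have hY : (y : ℝ) ≤ -1 := by exact_mod_cast (by omega : y ≤ -1)
    have hD : x * d / 2 ≤ |(x * d - y * d') / 2| := by
      refine le_trans ?_ (le_abs_self _)
      nlinarith
    rcases le_or_gt (x * q) (q' - q) with hc | hc
    · have hQ : (q' - x * q) / 2 ≤ |(x * q + y * q') / 2| := by
        refine le_trans ?_ (neg_le_abs _)
        nlinarith
      have h5 : (1 - ε) * q' ≤ x * (q' - x * q) := by
        nlinarith [mul_nonneg (sub_nonneg.2 hX) (by linarith : 0 ≤ q' - q - x * q)]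
      calc (1 - ε) * (q' * d) / 4 = ((1 - ε) * q') * (d / 4) := by ring
        _ ≤ (x * (q' - x * q)) * (d / 4) := by gcongr
        _ = ((q' - x * q) / 2) * (x * d / 2) := by ring
        _ ≤ _ := by gcongr
    · have h5 : (1 - ε) * q' ≤ 2 * (x * q) := by nlinarith
      calc (1 - ε) * (q' * d) / 4 = ((1 - ε) * q') * (d / 4) := by ring
        _ ≤ (2 * (x * q)) * (d / 4) := by gcongr
        _ = q * (x * d / 2) := by ring
        _ ≤ _ := by gcongr
  · have hy1 : y = 1 := by
      rw [abs_lt] at h2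
      have h3 : (y : ℝ) < 2 := by
        by_contra! h
        nlinarith
      have h4 : y < 2 := by exact_mod_cast h3
      rcases hy with ⟨k, hk⟩
      omega
    subst hy1
    have hD : (1 - ε) * d / 2 ≤ |(x * d - (1 : ℤ) * d') / 2| := by
      refine le_trans ?_ (le_abs_self _)
      push_cast
      nlinarith
    have hQ : q' / 2 ≤ |(x * q + (1 : ℤ) * q') / 2| := by
      refine le_trans ?_ (le_abs_self _)
      push_cast
      nlinarith
    calc (1 - ε) * (q' * d) / 4 = (q' / 2) * ((1 - ε) * d / 2) := by ring
      _ ≤ _ := by gcongr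

theorem odd_mul_sub_mul_iff {a b : ℤ} (ha : Odd a) (hb : Odd b) (P Q : ℤ) :
    Odd (P * a - Q * b) ↔ Odd (P + Q) := by
  obtain ⟨k, rfl⟩ := ha
  obtain ⟨l, rfl⟩ := hb
  rw [show P * (2 * k + 1) - Q * (2 * l + 1) = P + Q + 2 * (P * k - Q * l - Q) by ring,
    Int.odd_add]
  simp

/-- A vector whose coordinates have different parities is half an odd combination of two
consecutive Padé vectors. -/
theorem exists_odd_padeDen_combination (s : ℤ) (n : ℕ) {P Q : ℤ} (hPQ : Odd (P + Q)) :
    ∃ x y : ℤ, Odd x ∧ Odd y ∧ 2 * P = x * padeNum s n + y * padeNum s (n + 1) ∧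
      2 * Q = x * padeDen s n + y * padeDen s (n + 1) := by
  have hdet := padeNum_mul_padeDen_sub s n
  have hσ : ((-1) ^ n * (-1) ^ n : ℤ) = 1 := by rw [← mul_pow]; simp
  have hodd : Odd ((-1) ^ n : ℤ) := (by decide : Odd (-1 : ℤ)).pow
  have key : ∀ m, Odd (P * padeDen s m - Q * padeNum s m) := fun m =>
    (odd_mul_sub_mul_iff (padeDen_odd s m) (padeNum_odd s m) P Q).2 hPQ
  refine ⟨-((-1) ^ n * (P * padeDen s (n + 1) - Q * padeNum s (n + 1))),
    (-1) ^ n * (P * padeDen s n - Q * padeNum s n),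
    (hodd.mul (key _)).neg, hodd.mul (key _), ?_, ?_⟩
  · linear_combination (-P * (-1) ^ n) * hdet - 2 * P * hσ
  · linear_combination (-Q * (-1) ^ n) * hdet - 2 * Q * hσ

theorem exists_padeDen_le_lt {s : ℤ} (hs : 1 ≤ s) (m : ℕ) {Q : ℤ} (hQ : padeDen s m ≤ Q) :
    ∃ n, m ≤ n ∧ padeDen s n ≤ Q ∧ Q < padeDen s (n + 1) := by
  by_contra! h
  have h1 : ∀ k, padeDen s (m + k) ≤ Q := fun k => by
    induction k with
    | zero => exact hQ
    | succ k ih => exact h (m + k) (by omega) ih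
  have h2 := h1 (Q.toNat + 2)
  have h3 := le_padeDen_succ hs (m + Q.toNat + 1)
  rw [show m + Q.toNat + 1 + 1 = m + (Q.toNat + 2) by ring] at h3
  push_cast at h3
  omega

theorem exists_forall_le_mul_abs_exp {s : ℕ} (hs : 1 ≤ s) {ε : ℝ} (hε : 0 < ε) :
    ∃ M : ℤ, ∀ P Q : ℤ, Odd (P + Q) → M ≤ |Q| →
      1 / 2 - ε ≤ |(Q : ℝ)| * |Q * Real.exp (1 / s) - P| := by
  wlog hε1 : ε ≤ 1 generalizing ε
  · obtain ⟨M, hM⟩ := this one_pos le_rfl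
    exact ⟨M, fun P Q h h' => le_trans (by linarith) (hM P Q h h')⟩
  obtain ⟨m, hm⟩ := exists_nat_ge (1 / ε)
  have hs1 : (1 : ℤ) ≤ s := by exact_mod_cast hs
  have hs0 : (0 : ℝ) < s := by exact_mod_cast hs
  have ht : (0 : ℝ) < 1 / s := by positivity
  refine ⟨padeDen s m, fun P Q hPQ hQ => ?_⟩
  obtain ⟨n, hmn, hn1, hn2⟩ := exists_padeDen_le_lt hs1 m hQ
  obtain ⟨x, y, hx, hy, hP, hQ⟩ := exists_odd_padeDen_combination s n hPQ
  have hεn : 1 ≤ ε * n := by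
    have h1 : (m : ℝ) ≤ n := by exact_mod_cast hmn
    have h2 := (div_le_iff₀ hε).1 (hm.trans h1)
    linarith
  have hQ' : (Q : ℝ) = (x * padeDen s n + y * padeDen s (n + 1)) / 2 := by
    have : (2 * Q : ℝ) = x * padeDen s n + y * padeDen s (n + 1) := by exact_mod_cast hQ
    linarith
  have hP' : (P : ℝ) = (x * padeNum s n + y * padeNum s (n + 1)) / 2 := by
    have : (2 * P : ℝ) = x * padeNum s n + y * padeNum s (n + 1) := by exact_mod_cast hP
    linarith
  have hD : |Q * Real.exp (1 / s) - P| =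
      |(x * padeRem (1 / s) n - y * padeRem (1 / s) (n + 1)) / 2| := by
    have h0 := padeDen_mul_exp_sub_padeNum hs n
    have h1 := padeDen_mul_exp_sub_padeNum hs (n + 1)
    have e : Q * Real.exp (1 / s) - P =
        (-1) ^ n * ((x * padeRem (1 / s) n - y * padeRem (1 / s) (n + 1)) / 2) := by
      rw [hQ', hP']
      rw [pow_succ] at h1
      linear_combination x / 2 * h0 + y / 2 * h1
    rw [e, abs_mul]
    simp
  have hq : (0 : ℝ) < padeDen s n := by exact_mod_cast padeDen_pos hs1 n
  have hq' : (0 : ℝ) < padeDen s (n + 1) := by exact_mod_cast padeDen_pos hs1 (n + 1)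
  have hn1' : (padeDen s n : ℝ) ≤ |(Q : ℝ)| := by exact_mod_cast hn1
  have hn2' : |(Q : ℝ)| < padeDen s (n + 1) := by exact_mod_cast hn2
  have hqq : (n * padeDen s n : ℝ) ≤ padeDen s (n + 1) := by exact_mod_cast mul_padeDen_le hs1 n
  have hdd := mul_padeRem_succ_le hs n
  have hd' := padeRem_pos ht (n + 1)
  rw [hD]
  rw [hQ'] at hn1' hn2' ⊢
  refine le_abs_mul_abs_of_odd hq (padeRem_pos ht n) hd' hε hε1
    (padeDen_mul_padeRem hs n) ?_ ?_ hx hy hn1' hn2'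
  · nlinarith [mul_le_mul_of_nonneg_left hqq hε.le]
  · nlinarith [mul_le_mul_of_nonneg_left hdd hε.le]

theorem half_add_mul_half_add_le {q q' d d' n ε : ℝ} (hq : 0 < q) (hq' : 0 < q') (hd : 0 < d)
    (hd' : 0 < d') (hn : 4 ≤ n) (hdet : q' * d + q * d' = 2) (hqq : n * q ≤ q')
    (hdd : n * d' ≤ d) (hε : 2 ≤ ε * n) :
    (q' + q) / 2 * ((d + d') / 2) ≤ 1 / 2 + ε := by
  have h0 : 0 < q * d' := by positivity
  have h1 : n * (q * d) ≤ 2 := by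
    have := mul_le_mul_of_nonneg_right hqq hd.le
    linarith
  have h2 : n * (q' * d') ≤ 2 := by
    have := mul_le_mul_of_nonneg_left hdd hq'.le
    linarith
  have h3 : n * (q * d + q' * d') ≤ n * (2 * ε) := by linarith
  have h4 := le_of_mul_le_mul_left h3 (by linarith)
  have h5 : 0 < q * d + q' * d' := by positivity
  linarith

theorem abs_mul_abs_exp_le {s : ℕ} (hs : 1 ≤ s) {n : ℕ} (hn : 4 ≤ n) {ε : ℝ} (hε : 2 ≤ ε * n)
    {P Q x : ℤ} (hx : |x| = 1) (hP : 2 * P = padeNum s (n + 1) + x * padeNum s n)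
    (hQ : 2 * Q = padeDen s (n + 1) + x * padeDen s n) :
    |(Q : ℝ)| * |Q * Real.exp (1 / s) - P| ≤ 1 / 2 + ε := by
  have hs1 : (1 : ℤ) ≤ s := by exact_mod_cast hs
  have hs0 : (0 : ℝ) < s := by exact_mod_cast hs
  have ht : (0 : ℝ) < 1 / s := by positivity
  have hd := padeRem_pos ht n
  have hd' := padeRem_pos ht (n + 1)
  have hq : (0 : ℝ) < padeDen s n := by exact_mod_cast padeDen_pos hs1 n
  have hq' : (0 : ℝ) < padeDen s (n + 1) := by exact_mod_cast padeDen_pos hs1 (n + 1)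
  have hqq : (n * padeDen s n : ℝ) ≤ padeDen s (n + 1) := by exact_mod_cast mul_padeDen_le hs1 n
  have hxR : |(x : ℝ)| = 1 := by exact_mod_cast hx
  have hP' : (2 * P : ℝ) = padeNum s (n + 1) + x * padeNum s n := by exact_mod_cast hP
  have hQ' : (2 * Q : ℝ) = padeDen s (n + 1) + x * padeDen s n := by exact_mod_cast hQ
  have e : Q * Real.exp (1 / s) - P =
      (-1) ^ n * ((x * padeRem (1 / s) n - padeRem (1 / s) (n + 1)) / 2) := by
    have h0 := padeDen_mul_exp_sub_padeNum hs n
    have h1 := padeDen_mul_exp_sub_padeNum hs (n + 1)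
    rw [pow_succ] at h1
    linear_combination x / 2 * h0 + 1 / 2 * h1 + Real.exp (1 / s) / 2 * hQ' - hP' / 2
  have hQb : |(Q : ℝ)| ≤ (padeDen s (n + 1) + padeDen s n) / 2 := by
    rw [show (Q : ℝ) = (padeDen s (n + 1) + x * padeDen s n) / 2 by linarith, abs_div, abs_two]
    gcongr
    refine (abs_add_le _ _).trans ?_
    rw [abs_mul, hxR, one_mul, abs_of_pos hq, abs_of_pos hq']
  have hDb : |Q * Real.exp (1 / s) - P| ≤ (padeRem (1 / s) n + padeRem (1 / s) (n + 1)) / 2 := by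
    rw [e, abs_mul, abs_neg_one_pow, one_mul, abs_div, abs_two]
    gcongr
    refine (abs_sub _ _).trans ?_
    rw [abs_mul, hxR, one_mul, abs_of_pos hd, abs_of_pos hd']
  refine (mul_le_mul hQb hDb (abs_nonneg _) (by linarith)).trans ?_
  exact half_add_mul_half_add_le hq hq' hd hd' (by exact_mod_cast hn) (padeDen_mul_padeRem hs n)
    hqq (mul_padeRem_succ_le hs n) hε

theorem odd_add_of_two_mul_eq {s : ℤ} {n : ℕ} {P Q : ℤ}
    (hP : 2 * P = padeNum s (n + 1) + padeNum s n)
    (hQ : 2 * Q = padeDen s (n + 1) + padeDen s n) : Odd (P + Q) := by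
  have hdet := padeNum_mul_padeDen_sub s n
  have hodd : Odd ((-1) ^ n : ℤ) := (by decide : Odd (-1 : ℤ)).pow
  have h : P * padeDen s n - Q * padeNum s n = (-1) ^ n := by
    refine mul_left_cancel₀ (two_ne_zero (α := ℤ)) ?_
    linear_combination hdet + hP * padeDen s n - hQ * padeNum s n
  rwa [← h, odd_mul_sub_mul_iff (padeDen_odd s n) (padeNum_odd s n)] at hodd

theorem exists_mul_abs_exp_le {s : ℕ} (hs : 1 ≤ s) {ε : ℝ} (hε : 0 < ε) (M : ℤ) :
    (∃ P Q : ℤ, Odd P ∧ Even Q ∧ M ≤ Q ∧ |(Q : ℝ)| * |Q * Real.exp (1 / s) - P| ≤ 1 / 2 + ε) ∧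
    ∃ P Q : ℤ, Even P ∧ Odd Q ∧ M ≤ Q ∧ |(Q : ℝ)| * |Q * Real.exp (1 / s) - P| ≤ 1 / 2 + ε := by
  have hs1 : (1 : ℤ) ≤ s := by exact_mod_cast hs
  obtain ⟨m, hm⟩ := exists_nat_ge (2 / ε)
  obtain ⟨n, hn4, hnm, hnM⟩ : ∃ n : ℕ, 4 ≤ n ∧ m ≤ n ∧ 2 * M + 4 ≤ n :=
    ⟨4 + m + 2 * M.toNat, by omega, by omega, by omega⟩
  have hεn : 2 ≤ ε * n := by
    have := (div_le_iff₀ hε).1 (hm.trans (by exact_mod_cast hnm : (m : ℝ) ≤ n))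
    linarith
  have hq := padeDen_pos hs1 n
  have hqq := mul_padeDen_le hs1 n
  have hn4' : (4 : ℤ) ≤ n := by exact_mod_cast hn4
  have hM : 2 * M ≤ padeDen s (n + 1) - padeDen s n := by nlinarith
  obtain ⟨a, ha⟩ := padeNum_odd s n
  obtain ⟨b, hb⟩ := padeDen_odd s n
  obtain ⟨a', ha'⟩ := padeNum_odd s (n + 1)
  obtain ⟨b', hb'⟩ := padeDen_odd s (n + 1)
  have hodd : Odd ((a' + a + 1) + (b' + b + 1)) :=
    odd_add_of_two_mul_eq (s := s) (n := n) (by rw [ha, ha']; ring) (by rw [hb, hb']; ring)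
  have h1 := abs_mul_abs_exp_le hs hn4 hεn (P := a' + a + 1) (Q := b' + b + 1) (x := 1)
    (by decide) (by rw [ha, ha']; ring) (by rw [hb, hb']; ring)
  have h2 := abs_mul_abs_exp_le hs hn4 hεn (P := a' - a) (Q := b' - b) (x := -1)
    (by decide) (by rw [ha, ha']; ring) (by rw [hb, hb']; ring)
  have hM1 : M ≤ b' - b := by omega
  have hM2 : M ≤ b' + b + 1 := by omega
  rw [Int.odd_iff] at hodd
  rcases Int.even_or_odd (b' + b + 1) with h | h
  · rw [Int.even_iff] at h
    exact ⟨⟨_, _, by rw [Int.odd_iff]; omega, Int.even_iff.2 h, hM2, h1⟩,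
      ⟨_, _, by rw [Int.even_iff]; omega, by rw [Int.odd_iff]; omega, hM1, h2⟩⟩
  · rw [Int.odd_iff] at h
    exact ⟨⟨_, _, by rw [Int.odd_iff]; omega, by rw [Int.even_iff]; omega, hM1, h2⟩,
      ⟨_, _, by rw [Int.even_iff]; omega, Int.odd_iff.2 h, hM2, h1⟩⟩

theorem liminf_eq_of_forall_pos {α : Type*} {f : Filter α} {u : α → ℝ} {c : ℝ}
    (h1 : ∀ ε > 0, ∀ᶠ a in f, c - ε ≤ u a) (h2 : ∀ ε > 0, ∃ᶠ a in f, u a ≤ c + ε) :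
    liminf u f = c := by
  have hb : f.IsBoundedUnder (· ≥ ·) u := ⟨c - 1, h1 1 one_pos⟩
  have hc : f.IsCoboundedUnder (· ≥ ·) u := IsCoboundedUnder.of_frequently_le (h2 1 one_pos)
  refine le_antisymm ?_ ?_
  · exact le_of_forall_pos_le_add fun ε hε => liminf_le_of_frequently_le (h2 ε hε) hb
  · refine le_of_forall_pos_le_add fun ε hε => ?_
    have := le_liminf_of_le hc (h1 ε hε)
    linarith

theorem eventually_cofinite_le_abs (M : ℤ) : ∀ᶠ q : ℤ in cofinite, M ≤ |q| := by
  refine (Set.finite_Icc (-M) M).subset fun q hq => ?_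
  simp only [Set.mem_compl_iff, Set.mem_ofPred_eq, not_le] at hq
  exact ⟨(abs_lt.1 hq).1.le, (abs_lt.1 hq).2.le⟩

theorem frequently_cofinite_of_forall_exists_le {p : ℤ → Prop} (h : ∀ M : ℤ, ∃ q, M ≤ q ∧ p q) :
    ∃ᶠ q in cofinite, p q := by
  rw [frequently_cofinite_iff_infinite]
  refine Set.infinite_of_not_bddAbove fun ⟨B, hB⟩ => ?_
  obtain ⟨q, hq, hp⟩ := h (B + 1)
  have := hB hp
  omega

theorem distNearestInt_le (x : ℝ) (p : ℤ) : distNearestInt x ≤ |x - p| := round_le x p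

theorem Lconst_exp_one_half {s : ℕ} (hs : 1 ≤ s) : Lconst (Real.exp (1 / s)) (1 / 2) = 1 / 8 := by
  refine liminf_eq_of_forall_pos (fun ε hε => ?_) (fun ε hε => ?_)
  · obtain ⟨M, hM⟩ := exists_forall_le_mul_abs_exp hs hε
    filter_upwards [eventually_cofinite_le_abs M] with q hq
    unfold distNearestInt
    set p := round (q * Real.exp (1 / s) - 1 / 2)
    have h := hM (2 * p + 1) (2 * q) ⟨p + q, by ring⟩ (by rw [abs_mul]; norm_num; grind)
    have e : |(q : ℝ)| * |q * Real.exp (1 / s) - 1 / 2 - p| =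
        |((2 * q : ℤ) : ℝ)| * |(2 * q : ℤ) * Real.exp (1 / s) - (2 * p + 1 : ℤ)| / 4 := by
      rw [← abs_mul, ← abs_mul, ← abs_of_pos (four_pos : (0 : ℝ) < 4), ← abs_div]
      congr 1
      push_cast
      ring
    rw [e]
    linarith
  · refine frequently_cofinite_of_forall_exists_le fun M => ?_
    obtain ⟨P, Q, ⟨p, rfl⟩, ⟨q, rfl⟩, hQ, h⟩ := (exists_mul_abs_exp_le hs hε (2 * M)).1
    refine ⟨q, by omega, ?_⟩
    have e : |(q : ℝ)| * |q * Real.exp (1 / s) - 1 / 2 - p| =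
        |((q + q : ℤ) : ℝ)| * |(q + q : ℤ) * Real.exp (1 / s) - (2 * p + 1 : ℤ)| / 4 := by
      rw [← abs_mul, ← abs_mul, ← abs_of_pos (four_pos : (0 : ℝ) < 4), ← abs_div]
      congr 1
      push_cast
      ring
    refine (mul_le_mul_of_nonneg_left (distNearestInt_le _ p) (abs_nonneg _)).trans ?_
    rw [e]
    linarith

theorem Lconst_exp_exp_half {s : ℕ} (hs : 1 ≤ s) :
    Lconst (Real.exp (1 / s)) (Real.exp (1 / s) / 2) = 1 / 8 := by
  have e : ∀ p q : ℤ, |q * Real.exp (1 / s) - Real.exp (1 / s) / 2 - p| =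
        |(2 * q - 1 : ℤ) * Real.exp (1 / s) - (2 * p : ℤ)| / 2 := fun p q => by
    rw [← abs_two, ← abs_div, abs_two]
    congr 1
    push_cast
    ring
  refine liminf_eq_of_forall_pos (fun ε hε => ?_) (fun ε hε => ?_)
  · obtain ⟨M, hM⟩ := exists_forall_le_mul_abs_exp hs hε
    obtain ⟨K, hK⟩ := exists_int_gt (1 / ε)
    filter_upwards [eventually_cofinite_le_abs (M + 1), eventually_cofinite_le_abs (K + 1)]
      with q hq hq'
    unfold distNearestInt
    set p := round (q * Real.exp (1 / s) - Real.exp (1 / s) / 2)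
    have h := hM (2 * p) (2 * q - 1) ⟨p + q - 1, by ring⟩ (by grind)
    rw [e]
    have hqK : (K : ℝ) ≤ |(q : ℝ)| := by exact_mod_cast (by omega : K ≤ |q|)
    have hεq : 1 ≤ ε * |(q : ℝ)| := by
      have := (div_le_iff₀ hε).1 (hK.le.trans hqK)
      linarith
    have hQ : |((2 * q - 1 : ℤ) : ℝ)| ≤ 2 * |(q : ℝ)| + 1 := by
      push_cast
      refine (abs_sub _ _).trans ?_
      rw [abs_mul, abs_two, abs_one]
    have hD := abs_nonneg ((2 * q - 1 : ℤ) * Real.exp (1 / s) - (2 * p : ℤ))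
    have h1 := h.trans (mul_le_mul_of_nonneg_right hQ hD)
    have h2 := mul_le_mul_of_nonneg_right hεq hD
    set D := |((2 * q - 1 : ℤ) : ℝ) * Real.exp (1 / s) - (2 * p : ℤ)|
    rcases le_or_gt (1 / 4) (|(q : ℝ)| * D) with h3 | h3
    · linarith
    · nlinarith
  · refine frequently_cofinite_of_forall_exists_le fun M => ?_
    obtain ⟨K, hK⟩ := exists_int_gt (1 / ε)
    obtain ⟨P, Q, ⟨p, rfl⟩, ⟨q, rfl⟩, hQ, h⟩ :=
      (exists_mul_abs_exp_le hs (lt_min hε one_pos) (max (2 * M) K)).2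
    have hQM := (le_max_left _ _).trans hQ
    have hQK : (K : ℝ) ≤ (2 * q + 1 : ℤ) := by exact_mod_cast (le_max_right _ _).trans hQ
    refine ⟨q + 1, by omega, ?_⟩
    refine (mul_le_mul_of_nonneg_left (distNearestInt_le _ p) (abs_nonneg _)).trans ?_
    rw [e, show 2 * (q + 1) - 1 = 2 * q + 1 by ring, two_mul p]
    have hQ0 : (0 : ℝ) < (2 * q + 1 : ℤ) := (by positivity : 0 < 1 / ε).trans (hK.trans_le hQK)
    have hεQ : 1 ≤ ε * (2 * q + 1 : ℤ) := by
      have := (div_le_iff₀ hε).1 (hK.le.trans hQK)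
      linarith
    have hq : |((q + 1 : ℤ) : ℝ)| = ((2 * q + 1 : ℤ) + 1) / 2 := by
      push_cast at hQ0 ⊢
      rw [abs_of_pos (by linarith)]
      ring
    rw [abs_of_pos hQ0] at h
    rw [hq]
    have hD := abs_nonneg ((2 * q + 1 : ℤ) * Real.exp (1 / s) - (p + p : ℤ))
    have h1 := mul_le_mul_of_nonneg_right hεQ hD
    have h2 := h.trans (add_le_add_right (min_le_left ε 1) _)
    have h3 := h.trans (add_le_add_right (min_le_right ε 1) _)
    set D := |((2 * q + 1 : ℤ) : ℝ) * Real.exp (1 / s) - (p + p : ℤ)|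
    nlinarith

/-- For every integer `s ≥ 1`, `L(e^{1/s}, 1/2) = 1/8` and
`L(e^{1/s}, e^{1/s}/2) = 1/8`. -/
theorem Lconst_exp_one_half_eq_eighth (s : ℕ) (hs : 1 ≤ s) :
    Lconst (Real.exp (1 / s)) (1 / 2) = 1 / 8 ∧
    Lconst (Real.exp (1 / s)) (Real.exp (1 / s) / 2) = 1 / 8 :=
  ⟨Lconst_exp_one_half hs, Lconst_exp_exp_half hs⟩
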